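/- Let p ∈ [2,∞), let Q₀ ∈ 𝒟, and let f : ℝ^n × (0,∞) → [0,∞) be σ×η-measurable with ∬_{Q̂₀} f μ dη dσ < ∞. Let 𝓕 be the stopping family for f with top cube Q₀ and parameter A = 4^{2/p'}. Then there is a constant C_p depending only on p such that ∑_{F∈𝓕} [f]_F^p ‖φ_F‖_{L^p(σ;ℓ²)}^p ≤ C_p ‖f‖_{L^p(σ;ℓ²)}^p. -/

import Mathlib

open MeasureTheory ENNReal Set
open scoped Classical NNReal ENNReal

noncomputable section

/-- The index of a dyadic cube `2^{-k}([0,1)^n + m)` of the standard dyadic lattice `𝒟`. -/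
abbrev CubeIdx (n : ℕ) := ℤ × (Fin n → ℤ)

/-- The dyadic cube `2^{-k}([0,1)^n + m)`. -/
def dyadicCube (n : ℕ) (k : ℤ) (m : Fin n → ℤ) : Set (Fin n → ℝ) :=
  {x | ∀ i, x i ∈ Set.Ico ((2:ℝ) ^ (-k) * (m i : ℝ)) ((2:ℝ) ^ (-k) * ((m i : ℝ) + 1))}

/-- The dyadic cube associated to an index. -/
def idxCube (n : ℕ) (Q : CubeIdx n) : Set (Fin n → ℝ) := dyadicCube n Q.1 Q.2

/-- The Carleson box `Q̂ = Q × (0, ℓ(Q)]`, where `ℓ(Q) = 2^{-k}`. -/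
def carlesonBox (n : ℕ) (k : ℤ) (m : Fin n → ℤ) : Set ((Fin n → ℝ) × ℝ) :=
  (dyadicCube n k m) ×ˢ (Set.Ioc (0:ℝ) ((2:ℝ) ^ (-k)))

/-- The vertical `ℓ²`-norm `|f|_{ℓ²}(x) = (∑_{k ∈ ℤ} f(x, 2^{-k})²)^{1/2}`. -/
def vertL2 (n : ℕ) (f : (Fin n → ℝ) × ℝ → ℝ≥0∞) (x : Fin n → ℝ) : ℝ≥0∞ :=
  (∑' k : ℤ, (f (x, (2:ℝ) ^ (-k))) ^ 2) ^ (1/2 : ℝ)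

/-- The mixed norm `‖f‖_{L^q(σ; ℓ²)} = (∫ |f|_{ℓ²}^q dσ)^{1/q}`. -/
def mixedNorm (n : ℕ) (σ : Measure (Fin n → ℝ)) (q : ℝ)
    (f : (Fin n → ℝ) × ℝ → ℝ≥0∞) : ℝ≥0∞ :=
  (∫⁻ x, (vertL2 n f x) ^ q ∂σ) ^ (1/q)

/-- The norm `‖g‖_{L^q(ω)} = (∫ g^q dω)^{1/q}` of a nonnegative function. -/
def lpNorm (n : ℕ) (ω : Measure (Fin n → ℝ)) (q : ℝ) (g : (Fin n → ℝ) → ℝ≥0∞) : ℝ≥0∞ :=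
  (∫⁻ x, (g x) ^ q ∂ω) ^ (1/q)

/-- `∬_{Q̂} f μ dη dσ = ∑_{j ∈ ℤ, 2^j ≤ ℓ(Q)} ∫_Q f(x, 2^j) μ(x, 2^j) dσ(x)`. -/
def boxInt (n : ℕ) (σ : Measure (Fin n → ℝ)) (μ : (Fin n → ℝ) × ℝ → ℝ≥0∞)
    (f : (Fin n → ℝ) × ℝ → ℝ≥0∞) (k : ℤ) (m : Fin n → ℤ) : ℝ≥0∞ :=
  ∑' j : ℤ, if (2:ℝ) ^ j ≤ (2:ℝ) ^ (-k) then
      ∫⁻ x in dyadicCube n k m, f (x, (2:ℝ) ^ j) * μ (x, (2:ℝ) ^ j) ∂σ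
    else 0

/-- `1_{Q̂} μ`. -/
def boxFn (n : ℕ) (μ : (Fin n → ℝ) × ℝ → ℝ≥0∞) (k : ℤ) (m : Fin n → ℤ) :
    (Fin n → ℝ) × ℝ → ℝ≥0∞ :=
  (carlesonBox n k m).indicator μ

/-- The test function `φ_Q = |1_{Q̂} μ|_{ℓ²}^{p'-2} 1_{Q̂} μ`,
interpreted as `0` where `|1_{Q̂} μ|_{ℓ²} = 0`. -/
def testFn (n : ℕ) (p' : ℝ) (μ : (Fin n → ℝ) × ℝ → ℝ≥0∞) (k : ℤ) (m : Fin n → ℤ) :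
    (Fin n → ℝ) × ℝ → ℝ≥0∞ :=
  fun z => if vertL2 n (boxFn n μ k m) z.1 = 0 then 0
    else (vertL2 n (boxFn n μ k m) z.1) ^ (p' - 2) * boxFn n μ k m z

/-- The bilinear form `Λ(f,g) = ∑_{Q ∈ 𝒟} λ_Q (∬_{Q̂} f μ dη dσ) (∫_Q g dω)`. -/
def lambdaForm (n : ℕ) (σ ω : Measure (Fin n → ℝ)) (μ : (Fin n → ℝ) × ℝ → ℝ≥0∞)
    (lam : CubeIdx n → ℝ≥0) (f : (Fin n → ℝ) × ℝ → ℝ≥0∞) (g : (Fin n → ℝ) → ℝ≥0∞) :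
    ℝ≥0∞ :=
  ∑' Q : CubeIdx n,
    (lam Q : ℝ≥0∞) * boxInt n σ μ f Q.1 Q.2 * ∫⁻ x in idxCube n Q, g x ∂ω

/-- The localized bilinear form `Λ_{Q₀}(f,g)`, where the sum is restricted to
dyadic cubes `Q ⊆ Q₀`. -/
def lambdaLoc (n : ℕ) (σ ω : Measure (Fin n → ℝ)) (μ : (Fin n → ℝ) × ℝ → ℝ≥0∞)
    (lam : CubeIdx n → ℝ≥0) (Q₀ : CubeIdx n)
    (f : (Fin n → ℝ) × ℝ → ℝ≥0∞) (g : (Fin n → ℝ) → ℝ≥0∞) : ℝ≥0∞ :=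
  ∑' Q : CubeIdx n, if idxCube n Q ⊆ idxCube n Q₀ then
      (lam Q : ℝ≥0∞) * boxInt n σ μ f Q.1 Q.2 * ∫⁻ x in idxCube n Q, g x ∂ω
    else 0

/-- The average `⟨h⟩_Q^ν = ν(Q)⁻¹ ∫_Q h dν`, understood as `0` when `ν(Q) = 0`. -/
def cubeAvg (n : ℕ) (ν : Measure (Fin n → ℝ)) (h : (Fin n → ℝ) → ℝ≥0∞)
    (k : ℤ) (m : Fin n → ℤ) : ℝ≥0∞ :=
  (∫⁻ x in dyadicCube n k m, h x ∂ν) / ν (dyadicCube n k m)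


/-- `Q ∈ ch_𝓕(F)`: a maximal dyadic cube `Q ⊆ F` with
`(∬_{Q̂} f μ)(∬_{F̂} φ_F μ) > A (∬_{F̂} f μ)(∬_{Q̂} φ_F μ)`. -/
def fStopChild (n : ℕ) (σ : Measure (Fin n → ℝ)) (μ f : (Fin n → ℝ) × ℝ → ℝ≥0∞)
    (p' : ℝ) (A : ℝ≥0∞) (F Q : CubeIdx n) : Prop :=
  idxCube n Q ⊆ idxCube n F ∧
  A * (boxInt n σ μ f F.1 F.2 * boxInt n σ μ (testFn n p' μ F.1 F.2) Q.1 Q.2)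
    < boxInt n σ μ f Q.1 Q.2 * boxInt n σ μ (testFn n p' μ F.1 F.2) F.1 F.2 ∧
  ∀ Q' : CubeIdx n, idxCube n Q ⊂ idxCube n Q' → idxCube n Q' ⊆ idxCube n F →
    ¬ (A * (boxInt n σ μ f F.1 F.2 * boxInt n σ μ (testFn n p' μ F.1 F.2) Q'.1 Q'.2)
        < boxInt n σ μ f Q'.1 Q'.2 * boxInt n σ μ (testFn n p' μ F.1 F.2) F.1 F.2)

/-- The stopping family `𝓕 = ⋃_{k≥0} 𝓕_k` for `f` with top cube `Q₀` and parameter `A`: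
the smallest family containing `Q₀` and closed under taking stopping children. -/
inductive fStop (n : ℕ) (σ : Measure (Fin n → ℝ)) (μ f : (Fin n → ℝ) × ℝ → ℝ≥0∞)
    (p' : ℝ) (A : ℝ≥0∞) (Q₀ : CubeIdx n) : CubeIdx n → Prop
  | top : fStop n σ μ f p' A Q₀ Q₀
  | child {F Q : CubeIdx n} : fStop n σ μ f p' A Q₀ F → fStopChild n σ μ f p' A F Q →
      fStop n σ μ f p' A Q₀ Q

/-! ### Geometry of dyadic cubes -/

theorem mem_dyadicCube_iff {n : ℕ} {k : ℤ} {m : Fin n → ℤ} {x : Fin n → ℝ} :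
    x ∈ dyadicCube n k m ↔ ∀ i, (m i : ℝ) ≤ 2 ^ k * x i ∧ 2 ^ k * x i < m i + 1 := by
  have h2 : (0 : ℝ) < 2 ^ k := by positivity
  simp only [dyadicCube, Set.mem_ofPred_eq, Set.mem_Ico, zpow_neg, inv_mul_le_iff₀ h2,
    lt_inv_mul_iff₀ h2]

theorem idxCube_nonempty {n : ℕ} (Q : CubeIdx n) : (idxCube n Q).Nonempty := by
  refine ⟨fun i => 2 ^ (-Q.1) * Q.2 i, mem_dyadicCube_iff.2 fun i => ?_⟩
  have h2 : (2 : ℝ) ^ Q.1 * (2 ^ (-Q.1) * Q.2 i) = Q.2 i := by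
    rw [← mul_assoc, ← zpow_add₀ two_ne_zero]; simp
  rw [h2]
  exact ⟨le_rfl, lt_add_one _⟩

/-- Two intersecting dyadic cubes are nested, the one of smaller side being contained in the
other. -/
theorem idxCube_subset_of_mem {n : ℕ} {Q R : CubeIdx n} (h : R.1 ≤ Q.1) {x : Fin n → ℝ}
    (hxQ : x ∈ idxCube n Q) (hxR : x ∈ idxCube n R) : idxCube n Q ⊆ idxCube n R := by
  obtain ⟨d, hd⟩ := Int.le.dest h
  have h2 : (2 : ℝ) ^ Q.1 = 2 ^ R.1 * ((2 ^ d : ℤ) : ℝ) := by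
    rw [← hd, zpow_add₀ two_ne_zero]; simp
  have hpos : (0 : ℝ) < ((2 ^ d : ℤ) : ℝ) := by positivity
  intro y hy
  refine mem_dyadicCube_iff.2 fun i => ?_
  have hx1 := mem_dyadicCube_iff.1 hxQ i
  have hx2 := mem_dyadicCube_iff.1 hxR i
  have hy1 := mem_dyadicCube_iff.1 hy i
  rw [h2] at hx1 hy1
  generalize (2 ^ d : ℤ) = D at hx1 hy1 hpos
  have e1 : R.2 i * D < Q.2 i + 1 := by
    have : (R.2 i : ℝ) * D ≤ 2 ^ R.1 * x i * D := by gcongr; exact hx2.1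
    have : (R.2 i : ℝ) * D < Q.2 i + 1 := by linarith
    exact_mod_cast this
  have e2 : Q.2 i < (R.2 i + 1) * D := by
    have : 2 ^ R.1 * x i * D < ((R.2 i : ℝ) + 1) * D := by gcongr; exact hx2.2
    have : (Q.2 i : ℝ) < (R.2 i + 1) * D := by linarith
    exact_mod_cast this
  have e3 : (R.2 i : ℝ) * D ≤ Q.2 i := by exact_mod_cast Int.lt_add_one_iff.1 e1
  have e4 : (Q.2 i : ℝ) + 1 ≤ (R.2 i + 1) * D := by exact_mod_cast e2
  constructor
  · refine le_of_mul_le_mul_right ?_ hpos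
    linarith
  · refine lt_of_mul_lt_mul_right ?_ hpos.le
    linarith

theorem generation_le_of_idxCube_subset {n : ℕ} (hn : 0 < n) {Q R : CubeIdx n}
    (h : idxCube n Q ⊆ idxCube n R) : R.1 ≤ Q.1 := by
  by_contra! hlt
  have hpq : (2 : ℝ) ^ Q.1 < 2 ^ R.1 := zpow_lt_zpow_right₀ one_lt_two hlt
  have hQ : (0 : ℝ) < 2 ^ Q.1 := by positivity
  have hR : (0 : ℝ) < 2 ^ R.1 := by positivity
  have h1 : (fun i => (Q.2 i : ℝ) / 2 ^ Q.1) ∈ idxCube n Q := by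
    refine mem_dyadicCube_iff.2 fun i => ?_
    rw [mul_div_cancel₀ _ hQ.ne']
    exact ⟨le_rfl, lt_add_one _⟩
  have h2 : (fun i => (Q.2 i : ℝ) / 2 ^ Q.1 + 1 / 2 ^ R.1) ∈ idxCube n Q := by
    refine mem_dyadicCube_iff.2 fun i => ?_
    rw [mul_add, mul_div_cancel₀ _ hQ.ne', mul_one_div]
    have : (2 : ℝ) ^ Q.1 / 2 ^ R.1 < 1 := (div_lt_one hR).2 hpq
    exact ⟨le_add_of_nonneg_right (by positivity), by linarith⟩
  have h1 := mem_dyadicCube_iff.1 (h h1) ⟨0, hn⟩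
  have h2 := mem_dyadicCube_iff.1 (h h2) ⟨0, hn⟩
  rw [mul_add, mul_one_div_cancel hR.ne'] at h2
  linarith [h1.1, h2.2]

theorem idxCube_injective {n : ℕ} (hn : 0 < n) : Function.Injective (idxCube n) := by
  have key : ∀ (k : ℤ) (m m' : Fin n → ℤ), idxCube n (k, m) = idxCube n (k, m') → m = m' := by
    intro k m m' h
    obtain ⟨x, hx⟩ := idxCube_nonempty (k, m)
    have hx' := h ▸ hx
    funext i
    have h1 := mem_dyadicCube_iff.1 hx i
    have h2 := mem_dyadicCube_iff.1 hx' i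
    rw [← Int.floor_eq_iff] at h1 h2
    exact h1.symm.trans h2
  rintro ⟨k, m⟩ ⟨k', m'⟩ h
  obtain rfl : k = k' := le_antisymm (generation_le_of_idxCube_subset hn h.ge)
    (generation_le_of_idxCube_subset hn h.le)
  rw [key k m m' h]

theorem idxCube_subset_or_subset {n : ℕ} {Q R : CubeIdx n} {x : Fin n → ℝ}
    (hxQ : x ∈ idxCube n Q) (hxR : x ∈ idxCube n R) :
    idxCube n Q ⊆ idxCube n R ∨ idxCube n R ⊆ idxCube n Q :=
  (le_total R.1 Q.1).imp (fun h => idxCube_subset_of_mem h hxQ hxR)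
    (fun h => idxCube_subset_of_mem h hxR hxQ)

theorem measurableSet_dyadicCube (n : ℕ) (k : ℤ) (m : Fin n → ℤ) :
    MeasurableSet (dyadicCube n k m) := by
  have : dyadicCube n k m = Set.univ.pi fun i =>
      Set.Ico ((2:ℝ) ^ (-k) * (m i : ℝ)) ((2:ℝ) ^ (-k) * ((m i : ℝ) + 1)) := by
    ext x; simp [dyadicCube]
  rw [this]
  exact MeasurableSet.univ_pi fun i => measurableSet_Ico

theorem measurableSet_carlesonBox (n : ℕ) (k : ℤ) (m : Fin n → ℤ) :
    MeasurableSet (carlesonBox n k m) :=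
  (measurableSet_dyadicCube n k m).prod measurableSet_Ioc

/-- The Carleson box of the cube with index `Q`. -/
def idxBox (n : ℕ) (Q : CubeIdx n) : Set ((Fin n → ℝ) × ℝ) := carlesonBox n Q.1 Q.2

theorem measurableSet_idxBox {n : ℕ} (Q : CubeIdx n) : MeasurableSet (idxBox n Q) :=
  measurableSet_carlesonBox n Q.1 Q.2

theorem fst_mem_idxCube {n : ℕ} {Q : CubeIdx n} {z : (Fin n → ℝ) × ℝ} (h : z ∈ idxBox n Q) :
    z.1 ∈ idxCube n Q := h.1

theorem idxBox_subset {n : ℕ} (hn : 0 < n) {Q R : CubeIdx n}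
    (h : idxCube n Q ⊆ idxCube n R) : idxBox n Q ⊆ idxBox n R := by
  refine Set.prod_mono h (Set.Ioc_subset_Ioc_right ?_)
  have := generation_le_of_idxCube_subset hn h
  exact zpow_le_zpow_right₀ one_le_two (by lia)

/-! ### The product measure `σ × η` and mixed norms -/

/-- The measure `σ × η`, where `η = ∑ₖ δ_{2^k}`. -/
def sigmaEta (n : ℕ) (σ : Measure (Fin n → ℝ)) : Measure ((Fin n → ℝ) × ℝ) :=
  σ.prod (Measure.sum fun j : ℤ => Measure.dirac ((2 : ℝ) ^ (-j)))

theorem lintegral_sigmaEta {n : ℕ} (σ : Measure (Fin n → ℝ)) {g : (Fin n → ℝ) × ℝ → ℝ≥0∞}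
    (hg : Measurable g) :
    ∫⁻ z, g z ∂(sigmaEta n σ) = ∫⁻ x, ∑' j : ℤ, g (x, (2 : ℝ) ^ (-j)) ∂σ := by
  rw [sigmaEta, lintegral_prod _ hg.aemeasurable]
  refine lintegral_congr fun x => ?_
  rw [lintegral_sum_measure]
  refine tsum_congr fun j => ?_
  exact lintegral_dirac' _ (hg.comp measurable_prodMk_left)

theorem boxInt_eq_setLIntegral {n : ℕ} (σ : Measure (Fin n → ℝ)) {μ f : (Fin n → ℝ) × ℝ → ℝ≥0∞}
    (hμ : Measurable μ) (hf : Measurable f) (Q : CubeIdx n) :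
    boxInt n σ μ f Q.1 Q.2 = ∫⁻ z in idxBox n Q, f z * μ z ∂(sigmaEta n σ) := by
  have hfμ : Measurable fun z => f z * μ z := hf.mul hμ
  rw [← lintegral_indicator (measurableSet_idxBox Q),
    lintegral_sigmaEta σ (hfμ.indicator (measurableSet_idxBox Q)), lintegral_tsum, boxInt,
    ← (Equiv.neg ℤ).tsum_eq]
  · refine tsum_congr fun j => ?_
    simp only [Equiv.neg_apply]
    split_ifs with h
    · rw [← lintegral_indicator (measurableSet_dyadicCube _ _ _)]
      refine lintegral_congr fun x => ?_
      simp only [Set.indicator_apply]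
      refine if_congr ?_ rfl rfl
      simp only [idxBox, carlesonBox, Set.mem_prod, Set.mem_Ioc]
      exact ⟨fun hx => ⟨hx, by positivity, h⟩, fun hx => hx.1⟩
    · symm
      refine (lintegral_congr fun x => ?_).trans lintegral_zero
      exact Set.indicator_of_notMem (fun hx => h hx.2.2) _
  · exact fun j => ((hfμ.indicator (measurableSet_idxBox Q)).comp
      measurable_prodMk_right).aemeasurable

theorem measurable_vertL2 {n : ℕ} {f : (Fin n → ℝ) × ℝ → ℝ≥0∞} (hf : Measurable f) :
    Measurable (vertL2 n f) :=
  (Measurable.tsum fun _ => (hf.comp measurable_prodMk_right).pow_const 2).pow_const _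

theorem vertL2_sq (n : ℕ) (f : (Fin n → ℝ) × ℝ → ℝ≥0∞) (x : Fin n → ℝ) :
    vertL2 n f x ^ 2 = ∑' k : ℤ, f (x, (2:ℝ) ^ (-k)) ^ 2 := by
  rw [vertL2, ← ENNReal.rpow_natCast, ← ENNReal.rpow_mul]
  norm_num

theorem vertL2_mono {n : ℕ} {f g : (Fin n → ℝ) × ℝ → ℝ≥0∞} {x : Fin n → ℝ}
    (h : ∀ t, f (x, t) ≤ g (x, t)) : vertL2 n f x ≤ vertL2 n g x := by
  unfold vertL2
  gcongr
  exact h _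

theorem vertL2_const_mul {n : ℕ} {f g : (Fin n → ℝ) × ℝ → ℝ≥0∞} {x : Fin n → ℝ} {c : ℝ≥0∞}
    (h : ∀ t, f (x, t) = c * g (x, t)) : vertL2 n f x = c * vertL2 n g x := by
  simp only [vertL2, h, mul_pow, ENNReal.tsum_mul_left]
  rw [ENNReal.mul_rpow_of_nonneg _ _ (by norm_num), ← ENNReal.rpow_natCast, ← ENNReal.rpow_mul]
  norm_num

/-- Hölder's inequality for infinite sums of extended nonnegative reals. -/
theorem tsum_mul_le_Lp_mul_Lq {ι : Type*} {p q : ℝ} (hpq : p.HolderConjugate q)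
    (f g : ι → ℝ≥0∞) :
    ∑' i, f i * g i ≤ (∑' i, f i ^ p) ^ (1 / p) * (∑' i, g i ^ q) ^ (1 / q) := by
  let _ : MeasurableSpace ι := ⊤
  have := ENNReal.lintegral_mul_le_Lp_mul_Lq Measure.count hpq (f := f) (g := g)
    measurable_from_top.aemeasurable measurable_from_top.aemeasurable
  simpa only [lintegral_count, Pi.mul_apply] using this

theorem tsum_mul_le_vertL2_mul_vertL2 {n : ℕ} (f g : (Fin n → ℝ) × ℝ → ℝ≥0∞)
    (x : Fin n → ℝ) :
    ∑' k : ℤ, f (x, (2:ℝ) ^ (-k)) * g (x, (2:ℝ) ^ (-k)) ≤ vertL2 n f x * vertL2 n g x := by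
  have := tsum_mul_le_Lp_mul_Lq Real.HolderConjugate.two_two
    (fun k : ℤ => f (x, (2:ℝ) ^ (-k))) (fun k : ℤ => g (x, (2:ℝ) ^ (-k)))
  simpa only [vertL2, ENNReal.rpow_two] using this

/-- Hölder's inequality for the mixed norms. -/
theorem lintegral_mul_le_mixedNorm {n : ℕ} (σ : Measure (Fin n → ℝ)) {p q : ℝ}
    (hpq : p.HolderConjugate q) {f g : (Fin n → ℝ) × ℝ → ℝ≥0∞}
    (hf : Measurable f) (hg : Measurable g) :
    ∫⁻ z, f z * g z ∂(sigmaEta n σ) ≤ mixedNorm n σ p f * mixedNorm n σ q g := by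
  have hfg : Measurable fun z => f z * g z := hf.mul hg
  rw [lintegral_sigmaEta σ hfg]
  refine (lintegral_mono fun x => tsum_mul_le_vertL2_mul_vertL2 f g x).trans ?_
  exact ENNReal.lintegral_mul_le_Lp_mul_Lq σ hpq (measurable_vertL2 hf).aemeasurable
    (measurable_vertL2 hg).aemeasurable

theorem mixedNorm_rpow {n : ℕ} (σ : Measure (Fin n → ℝ)) {q : ℝ} (hq : q ≠ 0)
    (f : (Fin n → ℝ) × ℝ → ℝ≥0∞) : mixedNorm n σ q f ^ q = ∫⁻ x, vertL2 n f x ^ q ∂σ := by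
  rw [mixedNorm, ← ENNReal.rpow_mul, one_div_mul_cancel hq, ENNReal.rpow_one]

/-- For `q ≥ 2`, the `q`-th powers of the mixed norms of the restrictions of `g` to disjoint sets
add up to at most that of `g`. -/
theorem tsum_mixedNorm_indicator_rpow_le {n : ℕ} (σ : Measure (Fin n → ℝ)) {q : ℝ} (hq : 2 ≤ q)
    {ι : Type*} [Countable ι] {B : ι → Set ((Fin n → ℝ) × ℝ)} (hB : ∀ i, MeasurableSet (B i))
    (hd : Pairwise (Function.onFun Disjoint B)) {g : (Fin n → ℝ) × ℝ → ℝ≥0∞}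
    (hg : Measurable g) :
    ∑' i, mixedNorm n σ q ((B i).indicator g) ^ q ≤ mixedNorm n σ q g ^ q := by
  simp only [mixedNorm_rpow σ (show q ≠ 0 by linarith)]
  rw [← lintegral_tsum fun i => ((measurable_vertL2 (hg.indicator (hB i))).pow_const q).aemeasurable]
  refine lintegral_mono fun x => ?_
  have hsplit : ∀ a : ℝ≥0∞, a ^ q = a ^ 2 * a ^ (q - 2) := fun a => by
    rw [← ENNReal.rpow_two, ← ENNReal.rpow_add_of_nonneg _ _ (by norm_num) (by linarith)]
    ring_nf
  calc ∑' i, vertL2 n ((B i).indicator g) x ^ q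
      ≤ ∑' i, vertL2 n ((B i).indicator g) x ^ 2 * vertL2 n g x ^ (q - 2) := by
        refine ENNReal.tsum_le_tsum fun i => ?_
        rw [hsplit]
        gcongr
        exact vertL2_mono fun t => Set.indicator_le_self _ _ _
    _ = (∑' i, vertL2 n ((B i).indicator g) x ^ 2) * vertL2 n g x ^ (q - 2) :=
        ENNReal.tsum_mul_right
    _ ≤ vertL2 n g x ^ 2 * vertL2 n g x ^ (q - 2) := by
        gcongr
        simp only [vertL2_sq]
        rw [ENNReal.tsum_comm]
        refine ENNReal.tsum_le_tsum fun k => ?_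
        by_cases h : ∃ i, (x, (2:ℝ) ^ (-k)) ∈ B i
        · obtain ⟨i, hi⟩ := h
          rw [tsum_eq_single i, Set.indicator_of_mem hi]
          intro j hj
          rw [Set.indicator_of_notMem fun hjm => Set.disjoint_left.1 (hd hj) hjm hi]
          simp
        · push Not at h
          simp only [Set.indicator_of_notMem (h _)]
          simp
    _ = vertL2 n g x ^ q := (hsplit _).symm

/-- The `q`-th powers of the mixed norms of the restrictions of `g` to sets lying over disjoint
cubes add up to at most that of the restriction to the union. -/
theorem tsum_mixedNorm_indicator_le_iUnion {n : ℕ} (σ : Measure (Fin n → ℝ)) {q : ℝ} (hq : 0 < q)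
    {ι : Type*} [Countable ι] {Q : ι → CubeIdx n}
    (hd : Pairwise (Function.onFun Disjoint fun i => idxCube n (Q i)))
    {g : (Fin n → ℝ) × ℝ → ℝ≥0∞} (hg : Measurable g) :
    ∑' i, mixedNorm n σ q ((idxBox n (Q i)).indicator g) ^ q
      ≤ mixedNorm n σ q ((⋃ i, idxBox n (Q i)).indicator g) ^ q := by
  simp only [mixedNorm_rpow σ hq.ne']
  rw [← lintegral_tsum fun i => ((measurable_vertL2
    (hg.indicator (measurableSet_idxBox (Q i)))).pow_const q).aemeasurable]
  refine lintegral_mono fun x => ?_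
  have hzero : ∀ i, x ∉ idxCube n (Q i) →
      vertL2 n ((idxBox n (Q i)).indicator g) x ^ q = 0 := fun i hi => by
    have h0 : ∀ t, (idxBox n (Q i)).indicator g (x, t) = 0 := fun t =>
      Set.indicator_of_notMem (fun h => hi (fst_mem_idxCube h)) _
    simp [vertL2, h0, hq]
  by_cases h : ∃ i, x ∈ idxCube n (Q i)
  · obtain ⟨i, hi⟩ := h
    beta_reduce
    rw [tsum_eq_single i fun j hj => hzero j fun hjm => Set.disjoint_left.1 (hd hj) hjm hi]
    gcongr
    exact vertL2_mono fun t => Set.indicator_le_indicator_of_subset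
      (Set.subset_iUnion (fun i => idxBox n (Q i)) i) (fun _ => zero_le) _
  · push Not at h
    simp [hzero _ (h _)]

/-! ### The test functions -/

section TestFunction

variable {n : ℕ} {σ : Measure (Fin n → ℝ)} {μ : (Fin n → ℝ) × ℝ → ℝ≥0∞} {p q : ℝ}

theorem measurable_boxFn (hμ : Measurable μ) (F : CubeIdx n) :
    Measurable (boxFn n μ F.1 F.2) :=
  hμ.indicator (measurableSet_carlesonBox _ _ _)

/-- The factor `|1_{F̂} μ|_{ℓ²}^{q-2}` of the test function `φ_F`. -/
def testWeight (n : ℕ) (q : ℝ) (μ : (Fin n → ℝ) × ℝ → ℝ≥0∞) (F : CubeIdx n)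
    (x : Fin n → ℝ) : ℝ≥0∞ :=
  if vertL2 n (boxFn n μ F.1 F.2) x = 0 then 0 else vertL2 n (boxFn n μ F.1 F.2) x ^ (q - 2)

theorem testFn_eq (F : CubeIdx n) (z : (Fin n → ℝ) × ℝ) :
    testFn n q μ F.1 F.2 z = testWeight n q μ F z.1 * boxFn n μ F.1 F.2 z := by
  unfold testFn testWeight
  split_ifs <;> simp

theorem measurable_testWeight (hμ : Measurable μ) (F : CubeIdx n) :
    Measurable (testWeight n q μ F) := by
  have h := measurable_vertL2 (measurable_boxFn hμ F)
  exact Measurable.ite (h (measurableSet_singleton 0)) measurable_const (h.pow_const _)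

theorem measurable_testFn (hμ : Measurable μ) (F : CubeIdx n) :
    Measurable (testFn n q μ F.1 F.2) := by
  rw [funext (testFn_eq F)]
  exact ((measurable_testWeight hμ F).comp measurable_fst).mul (measurable_boxFn hμ F)

/-- The mass `‖1_{F̂} μ‖_{L^q(σ;ℓ²)}^q`. -/
def boxMass (n : ℕ) (σ : Measure (Fin n → ℝ)) (q : ℝ) (μ : (Fin n → ℝ) × ℝ → ℝ≥0∞)
    (F : CubeIdx n) : ℝ≥0∞ :=
  mixedNorm n σ q (boxFn n μ F.1 F.2) ^ q

theorem ae_vertL2_boxFn_lt_top (hq : 0 < q) (hμ : Measurable μ) {F : CubeIdx n}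
    (hF : boxMass n σ q μ F < ∞) : ∀ᵐ x ∂σ, vertL2 n (boxFn n μ F.1 F.2) x < ∞ := by
  rw [boxMass, mixedNorm_rpow σ hq.ne'] at hF
  filter_upwards [ae_lt_top ((measurable_vertL2 (measurable_boxFn hμ F)).pow_const q) hF.ne]
    with x hx
  exact (ENNReal.rpow_lt_top_iff_of_pos hq).1 hx

theorem setLIntegral_testFn_mul (hμ : Measurable μ) (F : CubeIdx n)
    {B : Set ((Fin n → ℝ) × ℝ)} (hB : MeasurableSet B) (hBF : B ⊆ idxBox n F) :
    ∫⁻ z in B, testFn n q μ F.1 F.2 z * μ z ∂(sigmaEta n σ)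
      = ∫⁻ x, testWeight n q μ F x * vertL2 n (B.indicator μ) x ^ 2 ∂σ := by
  have hm : Measurable fun z => testFn n q μ F.1 F.2 z * μ z := (measurable_testFn hμ F).mul hμ
  rw [← lintegral_indicator hB, lintegral_sigmaEta σ (hm.indicator hB)]
  refine lintegral_congr fun x => ?_
  rw [vertL2_sq, ← ENNReal.tsum_mul_left]
  refine tsum_congr fun j => ?_
  by_cases h : (x, (2:ℝ) ^ (-j)) ∈ B
  · have hF : boxFn n μ F.1 F.2 (x, (2:ℝ) ^ (-j)) = μ (x, (2:ℝ) ^ (-j)) :=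
      Set.indicator_of_mem (hBF h) _
    rw [Set.indicator_of_mem h, Set.indicator_of_mem h, testFn_eq, hF, mul_assoc, sq]
  · simp only [Set.indicator_of_notMem h]
    simp

theorem boxInt_testFn_self (hq : 0 < q) (hμ : Measurable μ) {F : CubeIdx n}
    (hF : boxMass n σ q μ F < ∞) :
    boxInt n σ μ (testFn n q μ F.1 F.2) F.1 F.2 = boxMass n σ q μ F := by
  rw [boxInt_eq_setLIntegral σ hμ (measurable_testFn hμ F),
    setLIntegral_testFn_mul hμ F (measurableSet_idxBox F) le_rfl, boxMass,
    mixedNorm_rpow σ hq.ne']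
  refine lintegral_congr_ae ?_
  filter_upwards [ae_vertL2_boxFn_lt_top hq hμ hF] with x hx
  change testWeight n q μ F x * vertL2 n (boxFn n μ F.1 F.2) x ^ 2 = _
  unfold testWeight
  split_ifs with h
  · simp [h, hq]
  · rw [← ENNReal.rpow_two, ← ENNReal.rpow_add _ _ h hx.ne]
    ring_nf

theorem mixedNorm_testFn_rpow (hpq : p.HolderConjugate q) (hμ : Measurable μ) {F : CubeIdx n}
    (hF : boxMass n σ q μ F < ∞) :
    mixedNorm n σ p (testFn n q μ F.1 F.2) ^ p = boxMass n σ q μ F := by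
  have hp := hpq.pos
  have hq := hpq.symm.pos
  rw [boxMass, mixedNorm_rpow σ hp.ne', mixedNorm_rpow σ hq.ne']
  refine lintegral_congr_ae ?_
  filter_upwards [ae_vertL2_boxFn_lt_top hq hμ hF] with x hx
  rw [vertL2_const_mul (c := testWeight n q μ F x) (g := boxFn n μ F.1 F.2)
    fun t => testFn_eq F (x, t)]
  unfold testWeight
  split_ifs with h
  · simp [h, hq, hp]
  · nth_rewrite 2 [← ENNReal.rpow_one (vertL2 n (boxFn n μ F.1 F.2) x)]
    rw [← ENNReal.rpow_add _ _ h hx.ne, ← ENNReal.rpow_mul]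
    congr 1
    linarith [hpq.mul_eq_add]

/-- Hölder's inequality comparing the mass of `μ` on `B ⊆ F̂` with the weighted mass
`∬_B φ_F μ`. -/
theorem mixedNorm_indicator_rpow_le (hq : 0 < q) (hq2 : q ≤ 2) (hμ : Measurable μ) {F : CubeIdx n}
    (hF : boxMass n σ q μ F < ∞) {B : Set ((Fin n → ℝ) × ℝ)} (hB : MeasurableSet B)
    (hBF : B ⊆ idxBox n F) :
    mixedNorm n σ q (B.indicator μ) ^ q
      ≤ (∫⁻ z in B, testFn n q μ F.1 F.2 z * μ z ∂(sigmaEta n σ)) ^ (q / 2)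
        * boxMass n σ q μ F ^ (1 - q / 2) := by
  rw [setLIntegral_testFn_mul hμ F hB hBF, boxMass, mixedNorm_rpow σ hq.ne',
    mixedNorm_rpow σ hq.ne']
  refine le_trans (lintegral_mono_ae ?_) (ENNReal.lintegral_mul_norm_pow_le
    (((measurable_testWeight hμ F).mul
      ((measurable_vertL2 (hμ.indicator hB)).pow_const 2)).aemeasurable)
    ((measurable_vertL2 (measurable_boxFn hμ F)).pow_const q).aemeasurable
    (by positivity) (by linarith) (by ring))
  filter_upwards [ae_vertL2_boxFn_lt_top hq hμ hF] with x hx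
  have hle : vertL2 n (B.indicator μ) x ≤ vertL2 n (boxFn n μ F.1 F.2) x :=
    vertL2_mono fun t => Set.indicator_le_indicator_of_subset hBF (fun _ => zero_le) _
  simp only [Pi.mul_apply, testWeight]
  split_ifs with h
  · rw [nonpos_iff_eq_zero.1 (hle.trans h.le)]
    simp [hq]
  · rw [ENNReal.mul_rpow_of_nonneg _ _ (by positivity), mul_right_comm, ← ENNReal.rpow_mul,
      ← ENNReal.rpow_mul, ← ENNReal.rpow_add _ _ h hx.ne, ← ENNReal.rpow_two,
      ← ENNReal.rpow_mul]
    refine le_of_eq ?_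
    rw [show (q - 2) * (q / 2) + q * (1 - q / 2) = 0 by ring, ENNReal.rpow_zero, one_mul]
    congr 1
    ring

end TestFunction

/-! ### The stopping family -/

section Stopping

variable {n : ℕ} {σ : Measure (Fin n → ℝ)} {μ f : (Fin n → ℝ) × ℝ → ℝ≥0∞} {p q : ℝ}
  {A : ℝ≥0∞} {Q₀ : CubeIdx n}

/-- The `k`-th generation of the stopping family. -/
def stopGen (n : ℕ) (σ : Measure (Fin n → ℝ)) (μ f : (Fin n → ℝ) × ℝ → ℝ≥0∞)
    (q : ℝ) (A : ℝ≥0∞) (Q₀ : CubeIdx n) : ℕ → Set (CubeIdx n)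
  | 0 => {Q₀}
  | k + 1 => {Q | ∃ F ∈ stopGen n σ μ f q A Q₀ k, fStopChild n σ μ f q A F Q}

theorem exists_mem_stopGen {F : CubeIdx n} (h : fStop n σ μ f q A Q₀ F) :
    ∃ k, F ∈ stopGen n σ μ f q A Q₀ k := by
  induction h with
  | top => exact ⟨0, rfl⟩
  | child _ hc ih =>
    obtain ⟨k, hk⟩ := ih
    exact ⟨k + 1, _, hk, hc⟩

theorem idxCube_subset_of_mem_stopGen {k : ℕ} : ∀ {F : CubeIdx n},
    F ∈ stopGen n σ μ f q A Q₀ k → idxCube n F ⊆ idxCube n Q₀ := by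
  induction k with
  | zero => rintro F rfl; exact le_rfl
  | succ k ih =>
    rintro Q ⟨F, hF, hQ⟩
    exact hQ.1.trans (ih hF)

theorem fStopChild_disjoint (hn : 0 < n) {F Q R : CubeIdx n} (hQ : fStopChild n σ μ f q A F Q)
    (hR : fStopChild n σ μ f q A F R) (hne : Q ≠ R) :
    Disjoint (idxCube n Q) (idxCube n R) := by
  have hne' : idxCube n Q ≠ idxCube n R := fun h => hne (idxCube_injective hn h)
  refine Set.disjoint_left.2 fun x hxQ hxR => ?_
  rcases idxCube_subset_or_subset hxQ hxR with h | h
  · exact hQ.2.2 R (h.ssubset_of_ne hne') hR.1 hR.2.1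
  · exact hR.2.2 Q (h.ssubset_of_ne hne'.symm) hQ.1 hQ.2.1

theorem stopGen_disjoint (hn : 0 < n) (k : ℕ) : ∀ {Q R : CubeIdx n},
    Q ∈ stopGen n σ μ f q A Q₀ k → R ∈ stopGen n σ μ f q A Q₀ k → Q ≠ R →
    Disjoint (idxCube n Q) (idxCube n R) := by
  induction k with
  | zero => rintro Q R rfl rfl h; exact absurd rfl h
  | succ k ih =>
    rintro Q R ⟨F, hF, hQ⟩ ⟨G, hG, hR⟩ hne
    by_cases hFG : F = G
    · subst hFG
      exact fStopChild_disjoint hn hQ hR hne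
    · exact (ih hF hG hFG).mono hQ.1 hR.1

theorem idxBox_disjoint {Q R : CubeIdx n} (h : Disjoint (idxCube n Q) (idxCube n R)) :
    Disjoint (idxBox n Q) (idxBox n R) :=
  Set.disjoint_left.2 fun _ hQ hR =>
    Set.disjoint_left.1 h (fst_mem_idxCube hQ) (fst_mem_idxCube hR)

theorem boxInt_mono (hn : 0 < n) (hμ : Measurable μ) (hf : Measurable f) {Q R : CubeIdx n}
    (h : idxCube n Q ⊆ idxCube n R) : boxInt n σ μ f Q.1 Q.2 ≤ boxInt n σ μ f R.1 R.2 := by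
  rw [boxInt_eq_setLIntegral σ hμ hf, boxInt_eq_setLIntegral σ hμ hf]
  exact lintegral_mono_set (idxBox_subset hn h)

theorem tsum_boxInt_eq_setLIntegral_iUnion (hμ : Measurable μ) (hf : Measurable f)
    {ι : Type*} [Countable ι] {Q : ι → CubeIdx n}
    (hd : Pairwise (Function.onFun Disjoint fun i => idxCube n (Q i))) :
    ∑' i, boxInt n σ μ f (Q i).1 (Q i).2
      = ∫⁻ z in ⋃ i, idxBox n (Q i), f z * μ z ∂(sigmaEta n σ) := by
  rw [lintegral_iUnion (fun i => measurableSet_idxBox (Q i)) fun i j hne =>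
    idxBox_disjoint (hd hne)]
  exact tsum_congr fun i => boxInt_eq_setLIntegral σ hμ hf (Q i)

/-- The masses of the stopping children of `F` add up to at most a quarter of that of `F`. -/
theorem tsum_boxMass_fStopChild_le (hn : 0 < n) (hq : 0 < q) (hq2 : q ≤ 2) (hμ : Measurable μ)
    (hf : Measurable f) {F : CubeIdx n} (hF : boxMass n σ q μ F < ∞)
    (hfin : boxInt n σ μ f F.1 F.2 < ∞) :
    ∑' Q : {Q // fStopChild n σ μ f q ((4 : ℝ≥0∞) ^ (2 / q)) F Q}, boxMass n σ q μ Q.1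
      ≤ 4⁻¹ * boxMass n σ q μ F := by
  set A := (4 : ℝ≥0∞) ^ (2 / q) with hA
  have hA0 : A ≠ 0 := (ENNReal.rpow_pos (by norm_num) (by norm_num)).ne'
  have hAtop : A ≠ ∞ := ENNReal.rpow_ne_top_of_nonneg (by positivity) (by norm_num)
  rcases isEmpty_or_nonempty {Q // fStopChild n σ μ f q A F Q} with hemp | ⟨⟨Q₁, hQ₁⟩⟩
  · simp
  have ha0 : boxInt n σ μ f F.1 F.2 ≠ 0 := fun h0 => by
    have h1 := hQ₁.2.1
    rw [nonpos_iff_eq_zero.1 ((boxInt_mono hn hμ hf hQ₁.1).trans h0.le)] at h1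
    simp at h1
  let U : Set ((Fin n → ℝ) × ℝ) :=
    ⋃ Q : {Q // fStopChild n σ μ f q A F Q}, idxBox n Q.1
  have hd : Pairwise (Function.onFun Disjoint
      fun Q : {Q // fStopChild n σ μ f q A F Q} => idxCube n Q.1) := fun Q R hne =>
    fStopChild_disjoint hn Q.2 R.2 fun h => hne (Subtype.ext h)
  have hUF : U ⊆ idxBox n F := Set.iUnion_subset fun Q => idxBox_subset hn Q.2.1
  have hU : MeasurableSet U := MeasurableSet.iUnion fun Q => measurableSet_idxBox Q.1
  have hφ := measurable_testFn (q := q) hμ F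
  set W := ∫⁻ z in U, testFn n q μ F.1 F.2 z * μ z ∂(sigmaEta n σ) with hW
  have hWsum : W = ∑' Q : {Q // fStopChild n σ μ f q A F Q},
      boxInt n σ μ (testFn n q μ F.1 F.2) Q.1.1 Q.1.2 :=
    (tsum_boxInt_eq_setLIntegral_iUnion hμ hφ hd).symm
  have hasum : ∑' Q : {Q // fStopChild n σ μ f q A F Q}, boxInt n σ μ f Q.1.1 Q.1.2
      ≤ boxInt n σ μ f F.1 F.2 := by
    rw [tsum_boxInt_eq_setLIntegral_iUnion hμ hf hd, boxInt_eq_setLIntegral σ hμ hf]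
    exact lintegral_mono_set hUF
  have hAW : A * W ≤ boxMass n σ q μ F := by
    have : boxInt n σ μ f F.1 F.2 * (A * W)
        ≤ boxInt n σ μ f F.1 F.2 * boxMass n σ q μ F := by
      calc boxInt n σ μ f F.1 F.2 * (A * W)
          = ∑' Q : {Q // fStopChild n σ μ f q A F Q}, A * (boxInt n σ μ f F.1 F.2
              * boxInt n σ μ (testFn n q μ F.1 F.2) Q.1.1 Q.1.2) := by
            rw [ENNReal.tsum_mul_left, ENNReal.tsum_mul_left, ← hWsum]
            ring
        _ ≤ ∑' Q : {Q // fStopChild n σ μ f q A F Q},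
              boxInt n σ μ f Q.1.1 Q.1.2 * boxMass n σ q μ F := by
            refine ENNReal.tsum_le_tsum fun Q => ?_
            rw [← boxInt_testFn_self hq hμ hF]
            exact Q.2.2.1.le
        _ ≤ _ := by
            rw [ENNReal.tsum_mul_right]
            gcongr
    exact (ENNReal.mul_le_mul_iff_right ha0 hfin.ne).1 this
  have hW' : W ≤ A⁻¹ * boxMass n σ q μ F := by
    rw [← ENNReal.mul_le_mul_iff_right hA0 hAtop, ← mul_assoc, ENNReal.mul_inv_cancel hA0 hAtop,
      one_mul]
    exact hAW
  calc ∑' Q : {Q // fStopChild n σ μ f q A F Q}, boxMass n σ q μ Q.1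
      ≤ mixedNorm n σ q (U.indicator μ) ^ q := tsum_mixedNorm_indicator_le_iUnion σ hq hd hμ
    _ ≤ W ^ (q / 2) * boxMass n σ q μ F ^ (1 - q / 2) :=
        mixedNorm_indicator_rpow_le hq hq2 hμ hF hU hUF
    _ ≤ (A⁻¹ * boxMass n σ q μ F) ^ (q / 2) * boxMass n σ q μ F ^ (1 - q / 2) := by gcongr
    _ = 4⁻¹ * boxMass n σ q μ F := by
        rw [ENNReal.mul_rpow_of_nonneg _ _ (by positivity), mul_assoc,
          ← ENNReal.rpow_add_of_nonneg _ _ (by positivity) (by linarith), ENNReal.inv_rpow, hA,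
          ← ENNReal.rpow_mul, div_mul_div_cancel₀ hq.ne', div_self two_ne_zero,
          add_sub_cancel, ENNReal.rpow_one, ENNReal.rpow_one]

/-- The quantity `[f]_F^p ‖φ_F‖_{L^p(σ;ℓ²)}^p`, expressed through the mass of `F`. -/
def boxEnergy (n : ℕ) (σ : Measure (Fin n → ℝ)) (p q : ℝ) (μ f : (Fin n → ℝ) × ℝ → ℝ≥0∞)
    (F : CubeIdx n) : ℝ≥0∞ :=
  (boxInt n σ μ f F.1 F.2 / boxMass n σ q μ F) ^ p * boxMass n σ q μ F

theorem setLIntegral_mul_le (hpq : p.HolderConjugate q) (hμ : Measurable μ) (hf : Measurable f)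
    {F : CubeIdx n} {B : Set ((Fin n → ℝ) × ℝ)} (hB : MeasurableSet B) (hBF : B ⊆ idxBox n F) :
    ∫⁻ z in B, f z * μ z ∂(sigmaEta n σ)
      ≤ mixedNorm n σ p (B.indicator f) * boxMass n σ q μ F ^ (1 / q) := by
  have h := lintegral_mul_le_mixedNorm σ hpq (hf.indicator hB) (measurable_boxFn hμ F)
  rw [boxMass, ← ENNReal.rpow_mul, mul_one_div_cancel hpq.symm.pos.ne', ENNReal.rpow_one]
  refine le_trans (le_of_eq ?_) h
  rw [← lintegral_indicator hB]
  refine lintegral_congr fun z => ?_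
  by_cases hz : z ∈ B
  · rw [Set.indicator_of_mem hz, Set.indicator_of_mem hz, boxFn,
      Set.indicator_of_mem (show z ∈ carlesonBox n F.1 F.2 from hBF hz)]
  · simp [hz]

theorem boxEnergy_le (hpq : p.HolderConjugate q) {F : CubeIdx n} (hF : boxMass n σ q μ F < ∞)
    {Y : ℝ≥0∞} (h : boxInt n σ μ f F.1 F.2 ≤ Y * boxMass n σ q μ F ^ (1 / q)) :
    boxEnergy n σ p q μ f F ≤ Y ^ p := by
  unfold boxEnergy
  generalize boxMass n σ q μ F = N at *
  rcases eq_or_ne N 0 with rfl | hN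
  · simp
  have hp := hpq.pos
  have hexp : (1 / q + -1) * p + 1 = 0 := by
    have := hpq.one_div_add_one_div
    have h1 : 1 / q + -1 = -(1 / p) := by linarith
    rw [h1]
    field_simp
    ring
  calc (boxInt n σ μ f F.1 F.2 / N) ^ p * N ≤ (Y * N ^ (1 / q) * N ^ (-1 : ℝ)) ^ p * N := by
        rw [ENNReal.rpow_neg_one, ← div_eq_mul_inv]
        gcongr
    _ = Y ^ p * (N ^ ((1 / q + -1) * p) * N ^ (1 : ℝ)) := by
        rw [mul_assoc, ← ENNReal.rpow_add _ _ hN hF.ne, ENNReal.mul_rpow_of_nonneg _ _ hp.le,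
          ← ENNReal.rpow_mul, ENNReal.rpow_one, mul_assoc]
    _ = Y ^ p := by
        rw [← ENNReal.rpow_add _ _ hN hF.ne, hexp, ENNReal.rpow_zero, mul_one]

theorem boxInt_le_boxEnergy (hpq : p.HolderConjugate q) (hμ : Measurable μ) (hf : Measurable f)
    {F : CubeIdx n} (hF : boxMass n σ q μ F < ∞) :
    boxInt n σ μ f F.1 F.2
      ≤ boxEnergy n σ p q μ f F ^ (1 / p) * boxMass n σ q μ F ^ (1 / q) := by
  have hp := hpq.pos
  have hq := hpq.symm.pos
  rcases eq_or_ne (boxMass n σ q μ F) 0 with hN | hN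
  · rw [boxInt_eq_setLIntegral σ hμ hf]
    refine (setLIntegral_mul_le hpq hμ hf (measurableSet_idxBox F) le_rfl).trans ?_
    simp [hN, hq]
  · unfold boxEnergy
    rw [ENNReal.mul_rpow_of_nonneg _ _ (by positivity), ← ENNReal.rpow_mul,
      mul_one_div_cancel hp.ne', ENNReal.rpow_one, mul_assoc, ← ENNReal.rpow_add _ _ hN hF.ne,
      hpq.one_div_add_one_div, div_one, ENNReal.rpow_one, ENNReal.div_mul_cancel hN hF.ne]

/-- The union of the Carleson boxes of the `k`-th generation. -/
def stopBox (n : ℕ) (σ : Measure (Fin n → ℝ)) (μ f : (Fin n → ℝ) × ℝ → ℝ≥0∞)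
    (q : ℝ) (A : ℝ≥0∞) (Q₀ : CubeIdx n) (k : ℕ) : Set ((Fin n → ℝ) × ℝ) :=
  ⋃ Q : stopGen n σ μ f q A Q₀ k, idxBox n Q.1

theorem measurableSet_stopBox (k : ℕ) : MeasurableSet (stopBox n σ μ f q A Q₀ k) :=
  MeasurableSet.iUnion fun Q => measurableSet_idxBox Q.1

theorem stopBox_antitone (hn : 0 < n) : Antitone (stopBox n σ μ f q A Q₀) := by
  refine antitone_nat_of_succ_le fun k => Set.iUnion_subset ?_
  rintro ⟨Q, F, hF, hQ⟩
  exact (idxBox_subset hn hQ.1).trans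
    (Set.subset_iUnion (fun Q : stopGen n σ μ f q A Q₀ k => idxBox n Q.1) ⟨F, hF⟩)

theorem idxBox_inter_stopBox_subset (hn : 0 < n) {k : ℕ} {F : CubeIdx n}
    (hF : F ∈ stopGen n σ μ f q A Q₀ k) :
    idxBox n F ∩ stopBox n σ μ f q A Q₀ (k + 1)
      ⊆ ⋃ Q : {Q // fStopChild n σ μ f q A F Q}, idxBox n Q.1 := by
  rintro z ⟨hzF, hz⟩
  obtain ⟨⟨Q, G, hG, hQ⟩, hzQ⟩ := Set.mem_iUnion.1 hz
  obtain rfl : F = G := by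
    by_contra hne
    exact Set.disjoint_left.1 (stopGen_disjoint hn k hF hG hne) (fst_mem_idxCube hzF)
      (hQ.1 (fst_mem_idxCube hzQ))
  exact Set.mem_iUnion.2 ⟨⟨Q, hQ⟩, hzQ⟩

theorem boxEnergy_le_add_tsum_fStopChild (hn : 0 < n) (hpq : p.HolderConjugate q) (hq2 : q ≤ 2)
    (hμ : Measurable μ) (hf : Measurable f) (hfinite : ∀ Q, boxMass n σ q μ Q < ∞)
    (hfin : boxInt n σ μ f Q₀.1 Q₀.2 < ∞) {k : ℕ} {F : CubeIdx n}
    (hF : F ∈ stopGen n σ μ f q ((4 : ℝ≥0∞) ^ (2 / q)) Q₀ k) :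
    boxEnergy n σ p q μ f F ≤ 2 ^ (p - 1) * mixedNorm n σ p ((idxBox n F \
        stopBox n σ μ f q ((4 : ℝ≥0∞) ^ (2 / q)) Q₀ (k + 1)).indicator f) ^ p
      + 2⁻¹ * ∑' Q : {Q // fStopChild n σ μ f q ((4 : ℝ≥0∞) ^ (2 / q)) F Q},
          boxEnergy n σ p q μ f Q.1 := by
  have hp := hpq.pos
  have hq := hpq.symm.pos
  have hp2 : 2 ≤ p := by
    nlinarith [hpq.mul_eq_add, hpq.symm.lt]
  have hsparse := tsum_boxMass_fStopChild_le hn hq hq2 hμ hf (hfinite F)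
    ((boxInt_mono hn hμ hf (idxCube_subset_of_mem_stopGen hF)).trans_lt hfin)
  set A := (4 : ℝ≥0∞) ^ (2 / q)
  set E := idxBox n F \ stopBox n σ μ f q A Q₀ (k + 1)
  set X := mixedNorm n σ p (E.indicator f)
  set S := ∑' Q : {Q // fStopChild n σ μ f q A F Q}, boxEnergy n σ p q μ f Q.1 with hS
  set N := boxMass n σ q μ F
  have hE : ∫⁻ z in E, f z * μ z ∂(sigmaEta n σ) ≤ X * N ^ (1 / q) :=
    setLIntegral_mul_le hpq hμ hf ((measurableSet_idxBox F).diff (measurableSet_stopBox _))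
      Set.sdiff_subset
  have hch : ∑' Q : {Q // fStopChild n σ μ f q A F Q}, boxInt n σ μ f Q.1.1 Q.1.2
      ≤ (4⁻¹ ^ (1 / q) * S ^ (1 / p)) * N ^ (1 / q) := by
    calc ∑' Q : {Q // fStopChild n σ μ f q A F Q}, boxInt n σ μ f Q.1.1 Q.1.2
        ≤ ∑' Q : {Q // fStopChild n σ μ f q A F Q},
            boxEnergy n σ p q μ f Q.1 ^ (1 / p) * boxMass n σ q μ Q.1 ^ (1 / q) :=
          ENNReal.tsum_le_tsum fun Q => boxInt_le_boxEnergy hpq hμ hf (hfinite Q.1)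
      _ ≤ S ^ (1 / p) * (∑' Q : {Q // fStopChild n σ μ f q A F Q},
            boxMass n σ q μ Q.1) ^ (1 / q) := by
          refine (tsum_mul_le_Lp_mul_Lq hpq _ _).trans (le_of_eq ?_)
          simp only [← ENNReal.rpow_mul, one_div_mul_cancel hp.ne', one_div_mul_cancel hq.ne',
            ENNReal.rpow_one, hS]
      _ ≤ S ^ (1 / p) * (4⁻¹ * N) ^ (1 / q) := by gcongr
      _ = _ := by
          rw [ENNReal.mul_rpow_of_nonneg _ _ (by positivity)]
          ring
  have ha : boxInt n σ μ f F.1 F.2 ≤ (X + 4⁻¹ ^ (1 / q) * S ^ (1 / p)) * N ^ (1 / q) := by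
    rw [boxInt_eq_setLIntegral σ hμ hf,
      ← lintegral_inter_add_sdiff _ (idxBox n F) (measurableSet_stopBox (k + 1)), add_mul, add_comm]
    refine add_le_add hE (le_trans ?_ hch)
    simp only [boxInt_eq_setLIntegral σ hμ hf]
    exact (lintegral_mono_set (idxBox_inter_stopBox_subset hn hF)).trans (lintegral_iUnion_le _ _)
  refine (boxEnergy_le hpq (hfinite F) ha).trans
    ((ENNReal.rpow_add_le_mul_rpow_add_rpow _ _ hpq.lt.le).trans ?_)
  rw [mul_add]
  refine add_le_add le_rfl ?_
  rw [ENNReal.mul_rpow_of_nonneg _ _ hp.le, ← ENNReal.rpow_mul, ← ENNReal.rpow_mul,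
    one_div_mul_cancel hp.ne', ENNReal.rpow_one, ← mul_assoc]
  gcongr
  have hexp : 1 / q * p = p - 1 := by
    have := hpq.one_div_add_one_div
    have h1 : 1 / q = 1 - 1 / p := by linarith
    rw [h1]
    field_simp
  rw [hexp, ← ENNReal.mul_rpow_of_nonneg _ _ (by linarith)]
  have h24 : (2 : ℝ≥0∞) * 4⁻¹ = 2⁻¹ := by
    rw [show (4 : ℝ≥0∞) = 2 * 2 by norm_num, ENNReal.mul_inv (by simp) (by simp), ← mul_assoc,
      ENNReal.mul_inv_cancel (by simp) (by simp), one_mul]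
  rw [h24]
  calc (2⁻¹ : ℝ≥0∞) ^ (p - 1) ≤ 2⁻¹ ^ (1 : ℝ) :=
        ENNReal.rpow_le_rpow_of_exponent_ge (by simp) (by linarith)
    _ = 2⁻¹ := ENNReal.rpow_one _

theorem tsum_boxEnergy_stopGen_le (hn : 0 < n) (hpq : p.HolderConjugate q) (hp2 : 2 ≤ p)
    (hμ : Measurable μ) (hf : Measurable f) (hfinite : ∀ Q, boxMass n σ q μ Q < ∞) (k : ℕ) :
    ∑' F : stopGen n σ μ f q A Q₀ k, boxEnergy n σ p q μ f F.1 ≤ mixedNorm n σ p f ^ p := by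
  refine le_trans (ENNReal.tsum_le_tsum fun F => boxEnergy_le hpq (hfinite F.1) ?_)
    (tsum_mixedNorm_indicator_rpow_le σ hp2
      (B := fun F : stopGen n σ μ f q A Q₀ k => idxBox n F.1)
      (fun F => measurableSet_idxBox F.1) (fun F G hne => idxBox_disjoint
      (stopGen_disjoint hn k F.2 G.2 fun h => hne (Subtype.ext h))) hf)
  rw [boxInt_eq_setLIntegral σ hμ hf]
  exact setLIntegral_mul_le hpq hμ hf (measurableSet_idxBox F.1) le_rfl

theorem tsum_tsum_mixedNorm_sdiff_stopBox_le (hn : 0 < n) (hp2 : 2 ≤ p) (hf : Measurable f) :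
    ∑' k, ∑' F : stopGen n σ μ f q A Q₀ k,
      mixedNorm n σ p ((idxBox n F.1 \ stopBox n σ μ f q A Q₀ (k + 1)).indicator f) ^ p
      ≤ mixedNorm n σ p f ^ p := by
  have hlt : ∀ {k l : ℕ}, k < l → ∀ (F : CubeIdx n) (G : stopGen n σ μ f q A Q₀ l),
      Disjoint (idxBox n F \ stopBox n σ μ f q A Q₀ (k + 1))
        (idxBox n G.1 \ stopBox n σ μ f q A Q₀ (l + 1)) := fun {k l} hkl F G =>
    Set.disjoint_left.2 fun z hF hG => hF.2 (stopBox_antitone hn hkl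
      (Set.mem_iUnion.2 ⟨G, hG.1⟩))
  rw [← ENNReal.tsum_sigma' fun i : Σ k, stopGen n σ μ f q A Q₀ k => mixedNorm n σ p
    ((idxBox n i.2.1 \ stopBox n σ μ f q A Q₀ (i.1 + 1)).indicator f) ^ p]
  refine tsum_mixedNorm_indicator_rpow_le σ hp2
    (fun i => (measurableSet_idxBox _).diff (measurableSet_stopBox _)) ?_ hf
  rintro ⟨k, F⟩ ⟨l, G⟩ hne
  rcases lt_trichotomy k l with h | rfl | h
  · exact hlt h F.1 G
  · refine (idxBox_disjoint (stopGen_disjoint hn k F.2 G.2 fun h => hne ?_)).mono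
      Set.sdiff_subset Set.sdiff_subset
    rw [Subtype.ext h]
  · exact (hlt h G.1 F).symm

theorem tsum_tsum_fStopChild_le (hn : 0 < n) (b : CubeIdx n → ℝ≥0∞) (k : ℕ) :
    ∑' F : stopGen n σ μ f q A Q₀ k, ∑' Q : {Q // fStopChild n σ μ f q A F.1 Q}, b Q.1
      ≤ ∑' Q : stopGen n σ μ f q A Q₀ (k + 1), b Q.1 := by
  rw [← ENNReal.tsum_sigma' fun i : Σ F : stopGen n σ μ f q A Q₀ k,
    {Q // fStopChild n σ μ f q A F.1 Q} => b i.2.1]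
  refine ENNReal.tsum_comp_le_tsum_of_injective
    (f := fun i : Σ F : stopGen n σ μ f q A Q₀ k, {Q // fStopChild n σ μ f q A F.1 Q} =>
      (⟨i.2.1, i.1.1, i.1.2, i.2.2⟩ : stopGen n σ μ f q A Q₀ (k + 1))) ?_ (fun Q => b Q.1)
  rintro ⟨⟨F, hF⟩, ⟨Q, hQ⟩⟩ ⟨⟨G, hG⟩, ⟨R, hR⟩⟩ h
  obtain rfl : Q = R := congrArg Subtype.val h
  obtain rfl : F = G := by
    by_contra hne
    obtain ⟨x, hx⟩ := idxCube_nonempty Q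
    exact Set.disjoint_left.1 (stopGen_disjoint hn k hF hG hne) (hQ.1 hx) (hR.1 hx)
  rfl

end Stopping

/-- A bounded sequence with `T k ≤ Y k + T (k + 1) / 2` and summable `Y` is summable. -/
theorem tsum_le_of_le_add_half_succ {T Y : ℕ → ℝ≥0∞} {X : ℝ≥0∞} (hX : X ≠ ∞)
    (hT : ∀ k, T k ≤ X) (h : ∀ k, T k ≤ Y k + 2⁻¹ * T (k + 1)) :
    ∑' k, T k ≤ 2 * ∑' k, Y k + X := by
  refine ENNReal.tsum_le_of_sum_range_le fun N => ?_
  set S := ∑ k ∈ Finset.range N, T k with hS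
  have hSfin : S ≠ ∞ := ENNReal.sum_ne_top.2 fun k _ => ne_top_of_le_ne_top hX (hT k)
  have hshift : ∑ k ∈ Finset.range N, T (k + 1) ≤ S + X := by
    calc ∑ k ∈ Finset.range N, T (k + 1) ≤ ∑ k ∈ Finset.range (N + 1), T k := by
          rw [Finset.sum_range_succ']
          exact le_self_add
      _ ≤ S + X := by
          rw [Finset.sum_range_succ]
          gcongr
          exact hT N
  have h1 : S ≤ ∑' k, Y k + 2⁻¹ * (S + X) := by
    calc S ≤ ∑ k ∈ Finset.range N, (Y k + 2⁻¹ * T (k + 1)) := Finset.sum_le_sum fun k _ => h k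
      _ = ∑ k ∈ Finset.range N, Y k + 2⁻¹ * ∑ k ∈ Finset.range N, T (k + 1) := by
          rw [Finset.sum_add_distrib, Finset.mul_sum]
      _ ≤ _ := by
          gcongr
          exact ENNReal.sum_le_tsum _
  have h2 : S + S ≤ S + (2 * ∑' k, Y k + X) := by
    calc S + S = 2 * S := (two_mul S).symm
      _ ≤ 2 * (∑' k, Y k + 2⁻¹ * (S + X)) := by gcongr
      _ = S + (2 * ∑' k, Y k + X) := by
          rw [mul_add, ← mul_assoc 2 2⁻¹, ENNReal.mul_inv_cancel (by simp) (by simp)]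
          ring
  exact (ENNReal.add_le_add_iff_left hSfin).1 h2

/-- Proposition 2.2 (the Carleson-type embedding theorem): for `p ∈ [2,∞)` and the stopping
family `𝓕` of `f` with top cube `Q₀` and parameter `A = 4^{2/p'}`,
`∑_{F ∈ 𝓕} [f]_F^p ‖φ_F‖_{L^p(σ;ℓ²)}^p ≤ C_p ‖f‖_{L^p(σ;ℓ²)}^p`, where
`[f]_F = (∬_{F̂} f μ)/(∬_{F̂} φ_F μ)` and `C_p` depends only on `p`. -/
theorem statement10 :
    ∀ p : ℝ, 2 ≤ p → ∃ C : ℝ≥0∞, C < ∞ ∧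
    ∀ (n : ℕ), 0 < n →
    ∀ σ : Measure (Fin n → ℝ), IsLocallyFiniteMeasure σ →
    ∀ μ : (Fin n → ℝ) × ℝ → ℝ≥0∞, Measurable μ →
    (∀ Q : CubeIdx n, mixedNorm n σ (p/(p-1)) (boxFn n μ Q.1 Q.2) < ∞) →
    ∀ Q₀ : CubeIdx n, ∀ f : (Fin n → ℝ) × ℝ → ℝ≥0∞, Measurable f →
    boxInt n σ μ f Q₀.1 Q₀.2 < ∞ →
      (∑' F : {F : CubeIdx n //
          fStop n σ μ f (p/(p-1)) ((4 : ℝ≥0∞) ^ (2/(p/(p-1)))) Q₀ F},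
        (boxInt n σ μ f F.1.1 F.1.2
            / boxInt n σ μ (testFn n (p/(p-1)) μ F.1.1 F.1.2) F.1.1 F.1.2) ^ p
          * mixedNorm n σ p (testFn n (p/(p-1)) μ F.1.1 F.1.2) ^ p)
      ≤ C * mixedNorm n σ p f ^ p := by
  intro p hp2
  refine ⟨2 * 2 ^ (p - 1) + 1, by finiteness, ?_⟩
  intro n hn σ _ μ hμ hmix Q₀ f hf hfin
  have hp : 1 < p := by linarith
  have hpq : p.HolderConjugate (p / (p - 1)) := Real.HolderConjugate.conjExponent hp
  have hq2 : p / (p - 1) ≤ 2 := by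
    rw [div_le_iff₀ (by linarith)]
    linarith
  set q := p / (p - 1)
  set A := (4 : ℝ≥0∞) ^ (2 / q)
  have hfinite : ∀ Q, boxMass n σ q μ Q < ∞ := fun Q =>
    (ENNReal.rpow_lt_top_iff_of_pos hpq.symm.pos).2 (hmix Q)
  have hterm : ∀ F : CubeIdx n,
      (boxInt n σ μ f F.1 F.2 / boxInt n σ μ (testFn n q μ F.1 F.2) F.1 F.2) ^ p
        * mixedNorm n σ p (testFn n q μ F.1 F.2) ^ p = boxEnergy n σ p q μ f F := fun F => by
    rw [boxInt_testFn_self hpq.symm.pos hμ (hfinite F), mixedNorm_testFn_rpow hpq hμ (hfinite F),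
      boxEnergy]
  simp only [hterm]
  rcases eq_or_ne (mixedNorm n σ p f ^ p) ∞ with htop | htop
  · rw [htop, ENNReal.mul_top (by simp)]
    exact le_top
  have hsub : {F | fStop n σ μ f q A Q₀ F} ⊆ ⋃ k, stopGen n σ μ f q A Q₀ k := fun F hF =>
    Set.mem_iUnion.2 (exists_mem_stopGen hF)
  have hstep : ∀ k, ∑' F : stopGen n σ μ f q A Q₀ k, boxEnergy n σ p q μ f F.1
      ≤ 2 ^ (p - 1) * ∑' F : stopGen n σ μ f q A Q₀ k, mixedNorm n σ p
          ((idxBox n F.1 \ stopBox n σ μ f q A Q₀ (k + 1)).indicator f) ^ p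
        + 2⁻¹ * ∑' F : stopGen n σ μ f q A Q₀ (k + 1), boxEnergy n σ p q μ f F.1 := fun k => by
    refine (ENNReal.tsum_le_tsum fun F : stopGen n σ μ f q A Q₀ k =>
      boxEnergy_le_add_tsum_fStopChild hn hpq hq2 hμ hf hfinite hfin F.2).trans ?_
    rw [ENNReal.tsum_add, ENNReal.tsum_mul_left, ENNReal.tsum_mul_left]
    gcongr
    exact tsum_tsum_fStopChild_le hn _ k
  calc ∑' F : {F : CubeIdx n // fStop n σ μ f q A Q₀ F}, boxEnergy n σ p q μ f F.1
      ≤ ∑' F : ⋃ k, stopGen n σ μ f q A Q₀ k, boxEnergy n σ p q μ f F.1 :=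
        ENNReal.tsum_mono_subtype _ hsub
    _ ≤ ∑' k, ∑' F : stopGen n σ μ f q A Q₀ k, boxEnergy n σ p q μ f F.1 :=
        ENNReal.tsum_iUnion_le_tsum _ _
    _ ≤ 2 * ∑' k, 2 ^ (p - 1) * ∑' F : stopGen n σ μ f q A Q₀ k, mixedNorm n σ p
          ((idxBox n F.1 \ stopBox n σ μ f q A Q₀ (k + 1)).indicator f) ^ p
          + mixedNorm n σ p f ^ p :=
        tsum_le_of_le_add_half_succ htop
          (tsum_boxEnergy_stopGen_le hn hpq hp2 hμ hf hfinite) hstep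
    _ ≤ (2 * 2 ^ (p - 1) + 1) * mixedNorm n σ p f ^ p := by
        rw [ENNReal.tsum_mul_left, add_mul, one_mul, mul_assoc]
        gcongr
        exact tsum_tsum_mixedNorm_sdiff_stopBox_le hn hp2 hf

end
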